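/- arXiv:2311.06358 — 2 statements merged into one kernel-verified Lean document; each statement's English description precedes it below -/
import Mathlib

section
/- Fix a positive integer n and natural numbers k, l. The set of matrices W : Matrix (Fin l → Fin n) (Fin k → Fin n) ℂ satisfying W * g^{⊗k} = g^{⊗l} * W for every g in the bistochastic group B_n — i.e. every real orthogonal n×n matrix g (g * gᵀ = 1) such that Σ_{j} g i j = 1 for every row i and Σ_{i} g i j = 1 for every column j — is a ℂ-subspace, and it is equal to the ℂ-linear span of the set {D_π : π a Setoid on Fin l ⊕ Fin k all of whose equivalence classes have cardinality one or two}. (This characterises the weight matrices of bistochastic-group equivariant layers, a characterisation not previously appearing in the machine learning literature.) -/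
open Matrix
open scoped Classical

/-- The partition matrix `D_π` of a set partition (Setoid) `π` of `α ⊕ β`:
`D_π I J = 1` if `Sum.elim I J` is constant on every block of `π`, else `0`. -/
noncomputable def Dmat (n : ℕ) {α β : Type*} (π : Setoid (α ⊕ β)) :
    Matrix (α → Fin n) (β → Fin n) ℂ :=
  Matrix.of fun I J =>
    if ∀ x y : α ⊕ β, π.r x y → Sum.elim I J x = Sum.elim I J y then 1 else 0

/-- The `k`-fold tensor power of a real `n × n` matrix, as a complex matrix:
`g^{⊗k} I J = ∏ a, g (I a) (J a)`. -/
noncomputable def tpow (n k : ℕ) (g : Matrix (Fin n) (Fin n) ℝ) :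
    Matrix (Fin k → Fin n) (Fin k → Fin n) ℂ :=
  Matrix.of fun I J => ∏ a : Fin k, ((g (I a) (J a) : ℝ) : ℂ)

/-- The action of the matrix `g^{⊗α}` on tensors with index positions `α`. -/
noncomputable def tensorAct {α ι κ : Type*} [Fintype α] [Fintype ι] (g : Matrix κ ι ℝ)
    (f : (α → ι) → ℝ) : (α → κ) → ℝ :=
  fun I => ∑ J : α → ι, (∏ a, g (I a) (J a)) * f J

/-- The action of the elementary matrix `E_{ij}`, as a derivation, on tensors. -/
noncomputable def elemAct {α ι : Type*} [Fintype α] (i j : ι)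
    (f : (α → ι) → ℝ) : (α → ι) → ℝ :=
  fun I => ∑ a, if I a = i then f (Function.update I a j) else 0

/-- The rotation by the angle `t` in the coordinate plane `(i, j)`. -/
noncomputable def planeRotation {ι : Type*} (i j : ι) (t : ℝ) : Matrix ι ι ℝ :=
  fun x y => (if x = y then 1 else 0)
    + (Real.cos t - 1) * ((if x = i ∧ y = i then 1 else 0) + (if x = j ∧ y = j then 1 else 0))
    + Real.sin t * ((if x = i ∧ y = j then 1 else 0) - (if x = j ∧ y = i then 1 else 0))

section
variable {α ι : Type*} [Fintype α] [Fintype ι]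

theorem planeRotation_mul_transpose {i j : ι} (hij : i ≠ j) (t : ℝ) :
    planeRotation i j t * (planeRotation i j t)ᵀ = 1 := by
  have h : planeRotation i j t = 1 + (Real.cos t - 1) • (single i i (1 : ℝ) + single j j 1)
      + Real.sin t • (single i j (1 : ℝ) - single j i 1) := by
    ext x y
    simp [planeRotation, single, one_apply, eq_comm, mul_add]
  have hji := hij.symm
  rw [h]
  simp only [transpose_add, transpose_sub, transpose_smul, transpose_one, transpose_single,
    add_mul, mul_add, sub_mul, mul_sub, smul_mul_assoc, mul_smul_comm, single_mul_single_same,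
    one_mul, mul_one]
  simp only [single_mul_single_of_ne _ _ _ _ hij, single_mul_single_of_ne _ _ _ _ hji]
  ext x y
  simp only [Matrix.add_apply, Matrix.sub_apply, Matrix.smul_apply, smul_eq_mul, Matrix.zero_apply]
  linear_combination (single i i (1:ℝ) x y + single j j (1:ℝ) x y) * (Real.sin_sq_add_cos_sq t)

/-- Invariance under rotations implies infinitesimal invariance. -/
theorem elemAct_comm_of_invariant {f : (α → ι) → ℝ}
    (hf : ∀ g : Matrix ι ι ℝ, g * gᵀ = 1 → tensorAct g f = f) (i j : ι) :
    elemAct i j f = elemAct j i f := by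
  by_cases hij : i = j
  · rw [hij]
  ext I
  let X : Matrix ι ι ℝ := fun x y =>
    (if x = i ∧ y = j then 1 else 0) - (if x = j ∧ y = i then 1 else 0)
  have hd : ∀ x y, HasDerivAt (fun t => planeRotation i j t x y) (X x y) 0 := by
    intro x y
    unfold planeRotation
    have h := (((Real.hasDerivAt_cos 0).sub_const 1).mul_const
      ((if x = i ∧ y = i then 1 else 0) + (if x = j ∧ y = j then 1 else 0) : ℝ)).const_add
        (if x = y then 1 else 0 : ℝ) |>.add ((Real.hasDerivAt_sin 0).mul_const (X x y))
    exact h.congr_deriv (by simp)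
  have h0 : ∀ x y, planeRotation i j 0 x y = if x = y then 1 else 0 := by
    intro x y; simp [planeRotation]
  have hD : HasDerivAt (fun t => tensorAct (planeRotation i j t) f I)
      (∑ J : α → ι, (∑ a, (∏ b ∈ Finset.univ.erase a, planeRotation i j 0 (I b) (J b)) •
        X (I a) (J a)) * f J) 0 := by
    unfold tensorAct
    refine HasDerivAt.fun_sum fun J _ => HasDerivAt.mul_const ?_ _
    exact HasDerivAt.fun_finsetProd fun a _ => hd _ _
  have hc : (fun t => tensorAct (planeRotation i j t) f I) = fun _ => f I := by
    ext t; rw [hf _ (planeRotation_mul_transpose hij t)]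
  rw [hc] at hD
  have hz := hD.unique (hasDerivAt_const 0 (f I))
  have key : ∀ a, ∑ J : α → ι, (∏ b ∈ Finset.univ.erase a, planeRotation i j 0 (I b) (J b)) *
        X (I a) (J a) * f J = (if I a = i then f (Function.update I a j) else 0) -
          (if I a = j then f (Function.update I a i) else 0) := by
    intro a
    have h1 : ∀ J : α → ι, (∏ b ∈ Finset.univ.erase a, planeRotation i j 0 (I b) (J b)) =
        if ∃ k, J = Function.update I a k then 1 else 0 := by
      intro J
      simp only [h0, Finset.prod_ite_zero, Finset.prod_const_one]
      congr 1
      apply propext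
      constructor
      · intro h
        refine ⟨J a, ?_⟩
        ext b
        by_cases hb : b = a
        · subst hb; simp
        · simp [hb, h b (by simp [hb])]
      · rintro ⟨k, rfl⟩ b hb
        simp [(Finset.mem_erase.1 hb).1]
    have h2 : ∀ F : (α → ι) → ℝ, (∑ J : α → ι, (if ∃ k, J = Function.update I a k then 1 else 0) *
        F J) = ∑ k, F (Function.update I a k) := by
      intro F
      rw [← Finset.sum_image (s := Finset.univ) (f := F)
        (fun x _ y _ h => Function.update_injective I a h)]
      simp only [ite_mul, one_mul, zero_mul, ← Finset.sum_filter]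
      congr 1
      ext J; simp [eq_comm]
    simp only [h1, mul_assoc, h2, X, Function.update_self]
    simp [sub_mul, Finset.sum_sub_distrib, ite_and]
  have : ∑ a, ((if I a = i then f (Function.update I a j) else 0) -
          (if I a = j then f (Function.update I a i) else 0)) = 0 := by
    refine Eq.trans ?_ hz
    rw [← Finset.sum_congr rfl fun a _ => key a, Finset.sum_comm]
    simp only [smul_eq_mul, Finset.sum_mul]
  rw [Finset.sum_sub_distrib, sub_eq_zero] at this
  exact this

/-- An orthogonally invariant tensor is supported on multi-indices in which every
value occurs an even number of times. -/
theorem even_card_of_invariant {f : (α → ι) → ℝ}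
    (hf : ∀ g : Matrix ι ι ℝ, g * gᵀ = 1 → tensorAct g f = f) {I : α → ι} (hI : f I ≠ 0) (i : ι) :
    Even (Finset.univ.filter fun a => I a = i).card := by
  have h := congrFun (hf (diagonal fun x => if x = i then -1 else 1) (by
    rw [diagonal_transpose, diagonal_mul_diagonal, ← diagonal_one]
    congr 1; ext x; split_ifs <;> simp)) I
  have h2 : tensorAct (diagonal fun x => if x = i then -1 else 1) f I =
      (-1) ^ (Finset.univ.filter fun a => I a = i).card * f I := by
    unfold tensorAct
    rw [Finset.sum_eq_single I]
    · simp [Finset.prod_ite]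
    · intro J _ hJ
      obtain ⟨a, ha⟩ := Function.ne_iff.1 hJ
      rw [Finset.prod_eq_zero (Finset.mem_univ a), zero_mul]
      exact diagonal_apply_ne _ ha.symm
    · simp
  rw [h2] at h
  by_contra ho
  rw [Nat.not_even_iff_odd] at ho
  rw [ho.neg_one_pow] at h
  exact hI (by linarith)

/-- A traceless orthogonally invariant tensor of positive order vanishes. -/
theorem eq_zero_of_invariant_of_traceless [Nonempty α] {f : (α → ι) → ℝ}
    (hf : ∀ g : Matrix ι ι ℝ, g * gᵀ = 1 → tensorAct g f = f)
    (ht : ∀ a b, a ≠ b → ∀ I, ∑ j, f (Function.update (Function.update I a j) b j) = 0) :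
    f = 0 := by
  have hcas : ∑ i, ∑ j, ∑ I, elemAct i j f I ^ 2 = ∑ I, (Fintype.card α : ℝ) * f I ^ 2 := by
    have h1 : ∀ i j I, elemAct i j f I ^ 2 =
        ∑ a, if I a = i then f (Function.update I a j) * elemAct j i f I else 0 := by
      intro i j I
      rw [sq]
      nth_rw 2 [elemAct_comm_of_invariant hf]
      conv_lhs => rw [elemAct, Finset.sum_mul]
      simp only [ite_mul, zero_mul]
    have h2 : ∀ a, ∑ i, ∑ j, ∑ I : α → ι,
        (if I a = i then f (Function.update I a j) * elemAct j i f I else 0) =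
        ∑ I : α → ι, f I ^ 2 := by
      intro a
      have e1 : ∑ i, ∑ j, ∑ I : α → ι,
        (if I a = i then f (Function.update I a j) * elemAct j i f I else 0) =
        ∑ p : (α → ι) × ι, f (Function.update p.1 a p.2) * elemAct p.2 (p.1 a) f p.1 := by
        rw [Fintype.sum_prod_type_right, Finset.sum_comm]
        refine Finset.sum_congr rfl fun j _ => ?_
        rw [Finset.sum_comm]
        simp
      have e2 : ∑ p : (α → ι) × ι, f (Function.update p.1 a p.2) * elemAct p.2 (p.1 a) f p.1 =
          ∑ p : (α → ι) × ι, f p.1 * elemAct (p.1 a) p.2 f (Function.update p.1 a p.2) := by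
        refine Finset.sum_nbij' (fun p => (Function.update p.1 a p.2, p.1 a))
          (fun p => (Function.update p.1 a p.2, p.1 a)) ?_ ?_ ?_ ?_ ?_ <;> simp
      rw [e1, e2, Fintype.sum_prod_type]
      refine Finset.sum_congr rfl fun I _ => ?_
      dsimp only
      rw [← Finset.mul_sum, sq]
      congr 1
      unfold elemAct
      rw [Finset.sum_comm, Finset.sum_eq_single a]
      · simp
      · intro b _ hb
        by_cases h : I b = I a
        · simpa [hb, h] using ht a b hb.symm I
        · simp [hb, h]
      · simp
    simp only [h1]
    calc _ = ∑ a : α, ∑ i, ∑ j, ∑ I : α → ι,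
        (if I a = i then f (Function.update I a j) * elemAct j i f I else 0) := by
          rw [Finset.sum_comm (γ := α)]
          refine Finset.sum_congr rfl fun i _ => ?_
          rw [Finset.sum_comm (γ := α)]
          refine Finset.sum_congr rfl fun j _ => ?_
          rw [Finset.sum_comm]
      _ = _ := by simp [h2, Finset.mul_sum]
  have hdiag : ∀ i I, elemAct i i f I = (Finset.univ.filter fun a => I a = i).card * f I := by
    intro i I
    unfold elemAct
    rw [← Finset.sum_filter, Finset.sum_congr rfl (g := fun _ => f I)]
    · simp
    · intro a ha
      rw [← (Finset.mem_filter.1 ha).2, Function.update_eq_self]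
  have hlow : ∑ I, 2 * (Fintype.card α : ℝ) * f I ^ 2 ≤ ∑ i, ∑ j, ∑ I, elemAct i j f I ^ 2 := by
    calc _ ≤ ∑ I, ∑ i, elemAct i i f I ^ 2 := by
          refine Finset.sum_le_sum fun I _ => ?_
          have hc : (Fintype.card α : ℝ) =
              ∑ i, ((Finset.univ.filter fun a => I a = i).card : ℝ) := by
            have h := Finset.card_eq_sum_card_fiberwise (s := Finset.univ) (t := Finset.univ)
              (f := I) (fun _ _ => Finset.mem_coe.2 (Finset.mem_univ _))
            rw [Finset.card_univ] at h
            rw [h, Nat.cast_sum]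
          rw [hc, Finset.mul_sum, Finset.sum_mul]
          refine Finset.sum_le_sum fun i _ => ?_
          rw [hdiag, mul_pow]
          by_cases hI : f I = 0
          · simp [hI]
          obtain ⟨c, hc⟩ := even_card_of_invariant hf hI i
          refine mul_le_mul_of_nonneg_right ?_ (sq_nonneg _)
          rw [hc]
          have : (c : ℝ) ≤ c * c := by exact_mod_cast Nat.le_mul_self c
          push_cast
          nlinarith
      _ = ∑ i, ∑ I, elemAct i i f I ^ 2 := Finset.sum_comm
      _ ≤ _ := by
          refine Finset.sum_le_sum fun i _ => ?_
          exact Finset.single_le_sum (f := fun j => ∑ I, elemAct i j f I ^ 2)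
            (fun j _ => Finset.sum_nonneg fun I _ => sq_nonneg _) (Finset.mem_univ i)
  have hs : ∑ I, f I ^ 2 ≤ 0 := by
    have hp : (0 : ℝ) < Fintype.card α := by exact_mod_cast Fintype.card_pos
    rw [hcas, ← Finset.mul_sum, ← Finset.mul_sum] at hlow
    by_contra! h
    nlinarith [mul_pos hp h]
  ext I
  have := (Finset.sum_eq_zero_iff_of_nonneg (fun I _ => sq_nonneg (f I))).1
    (le_antisymm hs (Finset.sum_nonneg fun I _ => sq_nonneg _)) I (Finset.mem_univ I)
  simpa using this

end

section
variable {α ι κ μ : Type*} [Fintype α]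

theorem sum_prod_mul_prod [Fintype κ] (g : Matrix μ κ ℝ) (h : Matrix κ ι ℝ)
    (I : α → μ) (J : α → ι) :
    ∑ K : α → κ, (∏ a, g (I a) (K a)) * ∏ a, h (K a) (J a) = ∏ a, (g * h) (I a) (J a) := by
  simp only [← Finset.prod_mul_distrib, Matrix.mul_apply]
  rw [Finset.prod_univ_sum, Fintype.piFinset_univ]

theorem prod_one_apply [DecidableEq ι] (I J : α → ι) :
    ∏ a, (1 : Matrix ι ι ℝ) (I a) (J a) = if I = J then 1 else 0 := by
  simp [one_apply, Finset.prod_ite_zero, funext_iff]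

variable [Fintype ι]

theorem tensorAct_add (g : Matrix κ ι ℝ) (f₁ f₂ : (α → ι) → ℝ) :
    tensorAct g (f₁ + f₂) = tensorAct g f₁ + tensorAct g f₂ := by
  ext I; simp [tensorAct, mul_add, Finset.sum_add_distrib]

theorem tensorAct_smul (g : Matrix κ ι ℝ) (c : ℝ) (f : (α → ι) → ℝ) :
    tensorAct g (c • f) = c • tensorAct g f := by
  ext I; simp [tensorAct, Finset.mul_sum, mul_left_comm]

theorem tensorAct_zero (g : Matrix κ ι ℝ) : tensorAct g (0 : (α → ι) → ℝ) = 0 := by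
  ext I; simp [tensorAct]

theorem tensorAct_mul [Fintype κ] (g : Matrix μ κ ℝ) (h : Matrix κ ι ℝ) (f : (α → ι) → ℝ) :
    tensorAct g (tensorAct h f) = tensorAct (g * h) f := by
  ext I
  simp only [tensorAct, ← sum_prod_mul_prod, Finset.mul_sum, Finset.sum_mul]
  rw [Finset.sum_comm]
  simp only [mul_assoc]

theorem tensorAct_one (f : (α → ι) → ℝ) : tensorAct (1 : Matrix ι ι ℝ) f = f := by
  ext I; simp [tensorAct, prod_one_apply]

end

/-- The orthogonal matrices all of whose row and column sums are `1`. -/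
structure IsBistochastic {ι : Type*} [Fintype ι] (g : Matrix ι ι ℝ) : Prop where
  mul_transpose : g * gᵀ = 1
  row_sum : ∀ i, ∑ j, g i j = 1
  col_sum : ∀ j, ∑ i, g i j = 1

theorem IsBistochastic.mul_transpose_eq_one {ι : Type*} [Fintype ι] [DecidableEq ι]
    {g : Matrix ι ι ℝ} (hg : IsBistochastic g) : g * gᵀ = 1 := by
  convert hg.mul_transpose

theorem IsBistochastic.transpose {ι : Type*} [Fintype ι] {g : Matrix ι ι ℝ}
    (hg : IsBistochastic g) : IsBistochastic gᵀ where
  mul_transpose := by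
    rw [transpose_transpose]; exact mul_eq_one_comm.1 hg.mul_transpose
  row_sum := hg.col_sum
  col_sum := hg.row_sum

/-- The tensor whose entry is `1` on multi-indices constant on the blocks of `π`. -/
noncomputable def blockTensor {α ι : Type*} (π : Setoid α) : (α → ι) → ℝ :=
  fun I => if ∀ x y, π x y → I x = I y then 1 else 0

/-- Every block of `π` has at most two elements. -/
def HasSmallBlocks {α : Type*} (π : Setoid α) : Prop :=
  ∀ x y z, π x y → π x z → x = y ∨ x = z ∨ y = z

/-- The multi-index agreeing with `I` where `p` holds and with `K` elsewhere. -/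
noncomputable def glue {α ι : Type*} (p : α → Prop) (I : {x // p x} → ι) (K : {x // ¬p x} → ι) :
    α → ι :=
  fun x => if h : p x then I ⟨x, h⟩ else K ⟨x, h⟩

/-- Contraction of the positions outside `p` of a tensor. -/
noncomputable def contract {α ι : Type*} [Fintype ι] (p : α → Prop) (f : (α → ι) → ℝ) :
    ({x // p x} → ι) → ℝ :=
  fun I => ∑ j, f (glue p I fun _ => j)

theorem hasSmallBlocks_iff {α : Type*} [Finite α] (π : Setoid α) :
    HasSmallBlocks π ↔ ∀ s ∈ π.classes, s.ncard = 1 ∨ s.ncard = 2 := by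
  constructor
  · rintro h s ⟨y, rfl⟩
    have h1 : 0 < {x | π x y}.ncard := (Set.ncard_pos).2 ⟨y, π.refl y⟩
    have h2 : ¬ 2 < {x | π x y}.ncard := by
      rw [Set.two_lt_ncard_iff]
      rintro ⟨a, b, c, ha, hb, hc, hab, hac, hbc⟩
      rcases h a b c (π.trans ha (π.symm hb)) (π.trans ha (π.symm hc)) with h | h | h
      exacts [hab h, hac h, hbc h]
    omega
  · intro h x y z hxy hxz
    by_contra! hne
    have h2 : 2 < {w | π w x}.ncard := by
      rw [Set.two_lt_ncard_iff]
      exact ⟨x, y, z, π.refl x, π.symm hxy, π.symm hxz, hne.1, hne.2.1, hne.2.2⟩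
    have := h _ ⟨x, rfl⟩
    omega

section
variable {α ι : Type*}

@[simp] theorem glue_coe (p : α → Prop) (I : {x // p x} → ι) (K : {x // ¬p x} → ι)
    (x : {x // p x}) : glue p I K x = I x := by
  simp [glue, x.2]

@[simp] theorem glue_coe_not (p : α → Prop) (I : {x // p x} → ι) (K : {x // ¬p x} → ι)
    (x : {x // ¬p x}) : glue p I K x = K x := by
  simp [glue, x.2]

theorem glue_restrict (p : α → Prop) (I : α → ι) :
    glue p (fun x => I x) (fun x => I x) = I := by
  ext x; simp [glue]

theorem blockTensor_glue {π : Setoid α} {p : α → Prop} (hp : ∀ x y, ¬p x → (π x y ↔ ¬p y))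
    (I : {x // p x} → ι) (K : {x // ¬p x} → ι) :
    blockTensor π (glue p I K) =
      blockTensor (π.comap Subtype.val) I * blockTensor ⊤ K := by
  unfold blockTensor
  rw [ite_zero_mul_ite_zero, mul_one]
  congr 1
  apply propext
  constructor
  · intro h
    refine ⟨fun x y hxy => ?_, fun x y _ => ?_⟩
    · simpa using h x y hxy
    · simpa using h x y ((hp _ _ x.2).2 y.2)
  · rintro ⟨h1, h2⟩ x y hxy
    by_cases hx : p x
    · have hy : p y := by
        by_contra hy
        exact (hp _ _ hy).1 (π.symm hxy) hx
      simpa [glue, hx, hy] using h1 ⟨x, hx⟩ ⟨y, hy⟩ hxy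
    · have hy := (hp _ _ hx).1 hxy
      simpa [glue, hx, hy] using h2 ⟨x, hx⟩ ⟨y, hy⟩ trivial

variable [Fintype α] [Fintype ι]

theorem sum_glue (p : α → Prop) (F : (α → ι) → ℝ) :
    ∑ J, F J = ∑ I : {x // p x} → ι, ∑ K : {x // ¬p x} → ι, F (glue p I K) := by
  rw [← Fintype.sum_prod_type', ← (Equiv.piEquivPiSubtypeProd p fun _ => ι).symm.sum_comp]
  rfl

theorem sum_blockTensor_top_mul [DecidableEq α] [Nonempty α] (F : (α → ι) → ℝ) :
    ∑ J, blockTensor ⊤ J * F J = ∑ j, F fun _ => j := by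
  rw [← Finset.sum_image (s := Finset.univ) (f := F) (g := fun j (_ : α) => j)
    (fun x _ y _ h => congrFun h (Classical.arbitrary α))]
  simp only [blockTensor, ite_mul, one_mul, zero_mul, ← Finset.sum_filter]
  congr 1
  ext J
  simp only [Finset.mem_filter, Finset.mem_univ, true_and, Finset.mem_image]
  constructor
  · intro h
    exact ⟨J (Classical.arbitrary α), funext fun x => h _ _ trivial⟩
  · rintro ⟨j, rfl⟩ _ _ _
    rfl

theorem IsBistochastic.sum_prod [Nonempty α] (hα : ∀ x y z : α, x = y ∨ x = z ∨ y = z)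
    {g : Matrix ι ι ℝ} (hg : IsBistochastic g) (I : α → ι) :
    ∑ j, ∏ a, g (I a) j = blockTensor ⊤ I := by
  by_cases hs : ∃ a b : α, a ≠ b
  · obtain ⟨a, b, hab⟩ := hs
    have hu : (Finset.univ : Finset α) = {a, b} := by
      ext z
      rcases hα a b z with h | h | h
      · exact absurd h hab
      · simp [h]
      · simp [h]
    have h := congrFun (congrFun hg.mul_transpose (I a)) (I b)
    rw [mul_apply] at h
    simp only [hu, Finset.prod_pair hab]
    rw [show ∑ j, g (I a) j * g (I b) j = _ from h, one_apply, blockTensor]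
    congr 1
    apply propext
    constructor
    · intro h x y _
      have hx : x ∈ ({a, b} : Finset α) := hu ▸ Finset.mem_univ x
      have hy : y ∈ ({a, b} : Finset α) := hu ▸ Finset.mem_univ y
      simp only [Finset.mem_insert, Finset.mem_singleton] at hx hy
      rcases hx with rfl | rfl <;> rcases hy with rfl | rfl <;> simp [h]
    · intro h
      exact h a b trivial
  · push Not at hs
    have : Subsingleton α := ⟨hs⟩
    let a : α := Classical.arbitrary α
    have hb : blockTensor ⊤ I = (1 : ℝ) := if_pos fun x y _ => by rw [hs x y]
    simp only [Fintype.prod_subsingleton _ a, hg.row_sum, hb]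

theorem tensorAct_apply_glue (p : α → Prop) (g : Matrix ι ι ℝ) (f : (α → ι) → ℝ)
    (I : {x // p x} → ι) (L : {x // ¬p x} → ι) :
    tensorAct g f (glue p I L) = ∑ J : {x // p x} → ι, ∑ K : {x // ¬p x} → ι,
      (∏ x, g (I x) (J x)) * (∏ x, g (L x) (K x)) * f (glue p J K) := by
  rw [tensorAct, sum_glue p]
  refine Finset.sum_congr rfl fun J _ => Finset.sum_congr rfl fun K _ => ?_
  rw [← Fintype.prod_subtype_mul_prod_subtype p]
  simp

theorem tensorAct_contract {p : α → Prop} (hne : ∃ a, ¬p a)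
    (hp : ∀ x y z, ¬p x → ¬p y → ¬p z → x = y ∨ x = z ∨ y = z)
    {g : Matrix ι ι ℝ} (hg : IsBistochastic g) {f : (α → ι) → ℝ} (hf : tensorAct g f = f) :
    tensorAct g (contract p f) = contract p f := by
  have : Nonempty {x // ¬p x} := let ⟨a, ha⟩ := hne; ⟨⟨a, ha⟩⟩
  have hs : ∀ x y z : {x // ¬p x}, x = y ∨ x = z ∨ y = z := fun x y z => by
    simpa [Subtype.ext_iff] using hp x y z x.2 y.2 z.2
  ext I
  symm
  calc contract p f I = ∑ j, tensorAct g f (glue p I fun _ => j) := by rw [hf]; rfl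
    _ = ∑ J : {x // p x} → ι, ∑ K : {x // ¬p x} → ι,
        ∑ j, (∏ x, g (I x) (J x)) * (∏ x, g j (K x)) * f (glue p J K) := by
      simp only [tensorAct_apply_glue]
      rw [Finset.sum_comm]
      refine Finset.sum_congr rfl fun J _ => ?_
      rw [Finset.sum_comm]
    _ = tensorAct g (contract p f) I := by
      refine Finset.sum_congr (by congr!) fun J _ => ?_
      rw [contract, ← sum_blockTensor_top_mul (α := {x // ¬p x}) (fun K => f (glue p J K)),
        Finset.mul_sum]
      refine Finset.sum_congr rfl fun K _ => ?_
      rw [← hg.transpose.sum_prod hs K, ← Finset.sum_mul, ← Finset.mul_sum, mul_assoc]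
      rfl

theorem sum_mul_blockTensor_top_eq_zero {p : α → Prop} (hne : ∃ a, ¬p a)
    {f F : (α → ι) → ℝ} (hf : contract p f = 0)
    (hF : ∀ I K K', F (glue p I K) = F (glue p I K')) :
    ∑ J, F J * blockTensor ⊤ (fun x : {x // ¬p x} => J x) * f J = 0 := by
  have : Nonempty {x // ¬p x} := let ⟨a, ha⟩ := hne; ⟨⟨a, ha⟩⟩
  rw [sum_glue p]
  refine Finset.sum_eq_zero fun I _ => ?_
  simp only [glue_coe_not]
  by_cases hK : Nonempty ({x // ¬p x} → ι)
  · obtain ⟨K₀⟩ := hK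
    simp only [fun K => hF I K K₀, mul_assoc]
    rw [← Finset.mul_sum, sum_blockTensor_top_mul]
    exact mul_eq_zero_of_right _ (congrFun hf I)
  · rw [not_nonempty_iff] at hK
    simp

end

theorem tensorAct_blockTensor {ι : Type*} [Fintype ι] {g : Matrix ι ι ℝ} (hg : IsBistochastic g)
    {α : Type*} [Fintype α] {π : Setoid α} (hπ : HasSmallBlocks π) :
    tensorAct g (blockTensor π) = blockTensor π := by
  induction hm : Fintype.card α using Nat.strong_induction_on generalizing α with
  | _ m ih =>
  cases isEmpty_or_nonempty α with
  | inl h =>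
    ext I
    simp [tensorAct, blockTensor]
  | inr h =>
    let a : α := Classical.arbitrary α
    let p : α → Prop := fun x => ¬π a x
    have ha : ¬p a := not_not.2 (π.refl a)
    have hp : ∀ x y, ¬p x → (π x y ↔ ¬p y) := fun x y hx => by
      simp only [p, not_not] at hx ⊢
      exact ⟨fun h => π.trans hx h, fun h => π.trans (π.symm hx) h⟩
    have : Nonempty {x // ¬p x} := ⟨⟨a, ha⟩⟩
    have hs : ∀ x y z : {x // ¬p x}, x = y ∨ x = z ∨ y = z := fun x y z => by
      simpa [Subtype.ext_iff] using
        hπ x y z ((hp _ _ x.2).2 y.2) ((hp _ _ x.2).2 z.2)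
    have hc : tensorAct g (blockTensor (π.comap (Subtype.val : {x // p x} → α))) =
        blockTensor (π.comap Subtype.val) := ih _ (hm ▸ Fintype.card_subtype_lt ha)
      (fun x y z hxy hxz => by simpa [Subtype.ext_iff] using hπ x y z hxy hxz) rfl
    ext I
    rw [← glue_restrict p I, tensorAct_apply_glue, blockTensor_glue hp, ← hc, tensorAct,
      Finset.sum_mul]
    refine Finset.sum_congr (by congr!) fun J _ => ?_
    rw [← hg.sum_prod hs, ← sum_blockTensor_top_mul (α := {x // ¬p x})
      (fun K => ∏ x : {x // ¬p x}, g (I x) (K x)), Finset.mul_sum]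
    refine Finset.sum_congr (by congr!) fun K _ => ?_
    rw [blockTensor_glue hp, mul_mul_mul_comm, mul_comm (blockTensor ⊤ K)]
    congr!

/-- An orthogonal matrix one of whose rows is constant. -/
theorem exists_orthogonal_const_row {ι : Type*} [Fintype ι] (i₀ : ι) :
    ∃ (U : Matrix ι ι ℝ) (c : ℝ), U * Uᵀ = 1 ∧ c ≠ 0 ∧ ∀ j, U i₀ j = c := by
  have hn : (0 : ℝ) < Fintype.card ι := by
    have : Nonempty ι := ⟨i₀⟩
    exact_mod_cast Fintype.card_pos
  let c : ℝ := (√(Fintype.card ι))⁻¹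
  let v : EuclideanSpace ℝ ι := WithLp.toLp 2 fun _ => c
  have hv : ‖v‖ = 1 := by
    rw [EuclideanSpace.norm_eq, Real.sqrt_eq_one]
    simp [v, c, Real.sq_sqrt hn.le, hn.ne']
  have ho : Orthonormal ℝ (({i₀} : Set ι).domRestrict fun _ => v) :=
    ⟨fun _ => hv, fun i j hij => absurd (Subsingleton.elim i j) hij⟩
  obtain ⟨b, hb⟩ := ho.exists_orthonormalBasis_extension_of_card_eq (by simp)
  refine ⟨of fun i j => b i j, c, ?_, by positivity, fun j => by rw [of_apply, hb i₀ rfl]⟩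
  ext i j
  have := orthonormal_iff_ite.1 b.orthonormal j i
  simpa [mul_apply, one_apply, PiLp.inner_apply, eq_comm] using this

section
variable {α ι : Type*} [Fintype α] [Fintype ι]

theorem tensorAct_eq_zero_of_const_row {κ : Type*} {a : α} {f : (α → ι) → ℝ}
    (hf : contract (fun x => ¬x = a) f = 0) {U : Matrix κ ι ℝ} {c : ℝ} {I : α → κ}
    (hU : ∀ j, U (I a) j = c) : tensorAct U f I = 0 := by
  have h := sum_mul_blockTensor_top_eq_zero (p := fun x => ¬x = a) ⟨a, by simp⟩ hf
    (F := fun J => ∏ b, U (I b) (J b)) (fun K L L' => ?_)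
  · rw [tensorAct, ← h]
    refine Finset.sum_congr rfl fun J _ => ?_
    have : blockTensor ⊤ (fun x : {x // ¬¬x = a} => J x) = (1 : ℝ) :=
      if_pos fun x y _ => congrArg J ((not_not.1 x.2).trans (not_not.1 y.2).symm)
    rw [this, mul_one]
  · refine Finset.prod_congr rfl fun b _ => ?_
    by_cases hb : b = a
    · rw [hb, hU, hU]
    · simp [glue, hb]

/-- Restricting an invariant tensor to the orthogonal complement of the constant vector
gives a traceless orthogonally invariant tensor, which therefore vanishes. -/
theorem tensorAct_eq_zero_of_contract_eq_zero [Nonempty α] {κ : Type*} [Fintype κ]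
    {f : (α → ι) → ℝ}
    (hf : ∀ g : Matrix ι ι ℝ, IsBistochastic g → tensorAct g f = f)
    (h1 : ∀ a : α, contract (fun x => ¬x = a) f = 0)
    (h2 : ∀ a b : α, a ≠ b → contract (fun x => ¬(x = a ∨ x = b)) f = 0)
    {B : Matrix κ ι ℝ} {c : ℝ} (hB : B * Bᵀ = 1) (hBc : Bᵀ * B = 1 - of fun _ _ => c)
    (hB0 : ∀ k, ∑ i, B k i = 0) (hc : ∑ _ : ι, c = 1) :
    tensorAct B f = 0 := by
  have hBJ : B * (of fun _ _ => c : Matrix ι ι ℝ) = 0 := by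
    ext k i
    simp [mul_apply, ← Finset.sum_mul, hB0]
  have hJB : (of fun _ _ => c : Matrix ι ι ℝ) * Bᵀ = 0 := by
    ext k i
    simp [mul_apply, ← Finset.mul_sum, hB0]
  have hJJ : (of fun _ _ => c : Matrix ι ι ℝ) * (of fun _ _ => c) = of fun _ _ => c := by
    ext k i
    simp only [mul_apply, of_apply, ← Finset.mul_sum, hc, mul_one]
  apply eq_zero_of_invariant_of_traceless
  · intro g hg
    have hb : IsBistochastic (Bᵀ * g * B + of fun _ _ => c) := by
      refine ⟨?_, fun i => ?_, fun i => ?_⟩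
      · rw [transpose_add, transpose_mul, transpose_mul, transpose_transpose]
        have ht : (of fun _ _ => c : Matrix ι ι ℝ)ᵀ = of fun _ _ => c := rfl
        rw [ht, add_mul, mul_add, mul_add, hJJ]
        have e1 : Bᵀ * g * B * (Bᵀ * (gᵀ * B)) = 1 - of fun _ _ => c := by
          calc _ = Bᵀ * (g * ((B * Bᵀ) * gᵀ)) * B := by simp only [Matrix.mul_assoc]
            _ = _ := by rw [hB, Matrix.one_mul, hg, Matrix.mul_one, hBc]
        have e2 : Bᵀ * g * B * (of fun _ _ => c : Matrix ι ι ℝ) = 0 := by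
          rw [Matrix.mul_assoc, hBJ, Matrix.mul_zero]
        have e3 : (of fun _ _ => c : Matrix ι ι ℝ) * (Bᵀ * (gᵀ * B)) = 0 := by
          rw [← Matrix.mul_assoc, hJB, Matrix.zero_mul]
        rw [e1, e2, e3]
        simp
      · simp only [Matrix.add_apply, Finset.sum_add_distrib, of_apply, hc, mul_apply (N := B)]
        rw [Finset.sum_comm]
        simp [← Finset.mul_sum, hB0]
      · simp only [Matrix.add_apply, Finset.sum_add_distrib, of_apply, hc, Matrix.mul_assoc,
          mul_apply (M := Bᵀ), transpose_apply]
        rw [Finset.sum_comm]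
        simp [← Finset.sum_mul, hB0]
    have hcomm : g * B = B * (Bᵀ * g * B + of fun _ _ => c) := by
      rw [Matrix.mul_add, hBJ, add_zero, ← Matrix.mul_assoc, ← Matrix.mul_assoc, hB,
        Matrix.one_mul]
    rw [tensorAct_mul, hcomm, ← tensorAct_mul, hf _ hb]
  · intro a b hab I
    let P : (α → ι) → ℝ := fun J => ∏ x ∈ (Finset.univ.erase a).erase b, B (I x) (J x)
    have hP : ∀ J : α → ι, ∑ j, ∏ x, B (Function.update (Function.update I a j) b j x) (J x) =
        P J * ((if J a = J b then 1 else 0) - c) := by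
      intro J
      have e : ((if J a = J b then 1 else 0) - c) = (Bᵀ * B) (J a) (J b) := by
        simp [hBc, one_apply]
      rw [e, mul_apply, Finset.mul_sum]
      refine Finset.sum_congr rfl fun j _ => ?_
      rw [← Finset.mul_prod_erase _ _ (Finset.mem_univ a),
        ← Finset.mul_prod_erase _ _ (Finset.mem_erase.2 ⟨hab.symm, Finset.mem_univ b⟩)]
      have e2 : ∏ x ∈ (Finset.univ.erase a).erase b,
          B (Function.update (Function.update I a j) b j x) (J x) = P J := by
        refine Finset.prod_congr rfl fun x hx => ?_
        simp only [Finset.mem_erase] at hx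
        simp [hx.1, hx.2.1]
      rw [e2]
      simp [hab]
      ring
    have hc1 : ∑ J, P J * f J = 0 := by
      have h := sum_mul_blockTensor_top_eq_zero (p := fun x => ¬x = a) ⟨a, by simp⟩ (h1 a)
        (F := P) (fun K L L' => Finset.prod_congr rfl fun x hx => ?_)
      · rw [← h]
        refine Finset.sum_congr rfl fun J _ => ?_
        have : blockTensor ⊤ (fun x : {x // ¬¬x = a} => J x) = (1 : ℝ) :=
          if_pos fun x y _ => congrArg J ((not_not.1 x.2).trans (not_not.1 y.2).symm)
        rw [this, mul_one]
      · simp only [Finset.mem_erase] at hx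
        simp [glue, hx.2.1]
    have hc2 : ∑ J, P J * (if J a = J b then 1 else 0) * f J = 0 := by
      have h := sum_mul_blockTensor_top_eq_zero (p := fun x => ¬(x = a ∨ x = b)) ⟨a, by simp⟩
        (h2 a b hab) (F := P) (fun K L L' => Finset.prod_congr rfl fun x hx => ?_)
      · rw [← h]
        refine Finset.sum_congr rfl fun J _ => ?_
        congr 2
        unfold blockTensor
        congr 1
        apply propext
        constructor
        · rintro h ⟨x, hx⟩ ⟨y, hy⟩ _
          rcases not_not.1 hx with rfl | rfl <;> rcases not_not.1 hy with rfl | rfl <;> simp [h]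
        · intro h
          exact h ⟨a, by simp⟩ ⟨b, by simp⟩ trivial
      · simp only [Finset.mem_erase] at hx
        simp [glue, hx.1, hx.2.1]
    simp only [tensorAct]
    rw [Finset.sum_comm]
    simp only [← Finset.sum_mul, hP, mul_sub, sub_mul]
    rw [Finset.sum_sub_distrib, hc2, zero_sub, neg_eq_zero, ← mul_zero c, ← hc1, Finset.mul_sum]
    refine Finset.sum_congr rfl fun J _ => ?_
    ring

theorem eq_zero_of_contract_eq_zero [Nonempty α] [Nonempty ι] {f : (α → ι) → ℝ}
    (hf : ∀ g : Matrix ι ι ℝ, IsBistochastic g → tensorAct g f = f)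
    (h1 : ∀ a : α, contract (fun x => ¬x = a) f = 0)
    (h2 : ∀ a b : α, a ≠ b → contract (fun x => ¬(x = a ∨ x = b)) f = 0) : f = 0 := by
  let i₀ : ι := Classical.arbitrary ι
  obtain ⟨U, c, hU, hc, hUc⟩ := exists_orthogonal_const_row i₀
  have hU' : Uᵀ * U = 1 := mul_eq_one_comm.1 hU
  let B : Matrix {i // ¬i = i₀} ι ℝ := U.submatrix Subtype.val id
  have hB : tensorAct B f = 0 := by
    refine tensorAct_eq_zero_of_contract_eq_zero hf h1 h2 (c := c * c) ?_ ?_ ?_ ?_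
    · ext k l
      have := congrFun (congrFun hU k) l
      simpa [mul_apply, one_apply, B, Subtype.ext_iff] using this
    · ext i j
      have := congrFun (congrFun hU' i) j
      rw [mul_apply, ← Fintype.sum_subtype_add_sum_subtype (fun k => k = i₀)] at this
      have hd : ((default : {k // k = i₀}) : ι) = i₀ := (default : {k // k = i₀}).2
      rw [Matrix.sub_apply, ← this, mul_apply]
      simp [hUc, B, hd]
    · intro k
      have := congrFun (congrFun hU k) i₀
      rw [mul_apply, one_apply_ne k.2] at this
      simp only [transpose_apply, hUc, ← Finset.sum_mul] at this
      exact (mul_eq_zero.1 this).resolve_right hc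
    · have := congrFun (congrFun hU i₀) i₀
      simpa [mul_apply, hUc] using this
  have hUf : tensorAct U f = 0 := by
    ext I
    by_cases hI : ∃ a, I a = i₀
    · obtain ⟨a, ha⟩ := hI
      exact tensorAct_eq_zero_of_const_row (h1 a) (by rw [ha]; exact hUc)
    · push Not at hI
      exact congrFun hB fun a => ⟨I a, hI a⟩
  rw [← tensorAct_one f, ← hU', ← tensorAct_mul, hUf, tensorAct_zero]

/-- The partition of `α` extending the partition `π` of `p` by one further block. -/
def extendSetoid {α : Type*} (p : α → Prop) (π : Setoid {x // p x}) : Setoid α where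
  r x y := (∃ hx hy, π ⟨x, hx⟩ ⟨y, hy⟩) ∨ (¬p x ∧ ¬p y)
  iseqv :=
    { refl := fun x => by
        by_cases hx : p x
        · exact Or.inl ⟨hx, hx, π.refl _⟩
        · exact Or.inr ⟨hx, hx⟩
      symm := by
        rintro x y (⟨hx, hy, h⟩ | ⟨hx, hy⟩)
        · exact Or.inl ⟨hy, hx, π.symm h⟩
        · exact Or.inr ⟨hy, hx⟩
      trans := by
        rintro x y z (⟨hx, hy, h⟩ | ⟨hx, hy⟩) (⟨hy', hz, h'⟩ | ⟨hy', hz⟩)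
        · exact Or.inl ⟨hx, hz, π.trans h h'⟩
        · exact absurd hy hy'
        · exact absurd hy' hy
        · exact Or.inr ⟨hx, hz⟩ }

theorem sum_blockTensor_mul_contract {p : α → Prop} (hne : ∃ a, ¬p a) (π : Setoid {x // p x})
    (f : (α → ι) → ℝ) :
    ∑ I, blockTensor π I * contract p f I = ∑ I, blockTensor (extendSetoid p π) I * f I := by
  have : Nonempty {x // ¬p x} := let ⟨a, ha⟩ := hne; ⟨⟨a, ha⟩⟩
  have hp : ∀ x y, ¬p x → (extendSetoid p π x y ↔ ¬p y) := by
    intro x y hx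
    constructor
    · rintro (⟨h, -⟩ | ⟨-, h⟩)
      · exact absurd h hx
      · exact h
    · exact fun hy => Or.inr ⟨hx, hy⟩
  have hc : (extendSetoid p π).comap Subtype.val = π := by
    ext x y
    constructor
    · rintro (⟨_, _, h⟩ | ⟨h, -⟩)
      · exact h
      · exact absurd x.2 h
    · exact fun h => Or.inl ⟨x.2, y.2, h⟩
  rw [sum_glue p]
  refine Finset.sum_congr (by congr!) fun I _ => ?_
  simp only [blockTensor_glue hp, hc, mul_assoc]
  rw [← Finset.mul_sum, contract,
    sum_blockTensor_top_mul (α := {x // ¬p x}) (fun K => f (glue p I K))]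

end

/-- An invariant tensor orthogonal to all small-block tensors vanishes. -/
theorem eq_zero_of_forall_sum_blockTensor {ι : Type*} [Fintype ι] [Nonempty ι]
    {α : Type*} [Fintype α] {f : (α → ι) → ℝ}
    (hf : ∀ g : Matrix ι ι ℝ, IsBistochastic g → tensorAct g f = f)
    (ho : ∀ π : Setoid α, HasSmallBlocks π → ∑ I, blockTensor π I * f I = 0) : f = 0 := by
  induction hm : Fintype.card α using Nat.strong_induction_on generalizing α with
  | _ m ih =>
  cases isEmpty_or_nonempty α with
  | inl h =>
    have := ho ⊥ fun x => h.elim x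
    ext I
    rw [Fintype.sum_eq_single I fun J hJ => absurd (Subsingleton.elim J I) hJ] at this
    simpa [blockTensor] using this
  | inr h =>
    have key : ∀ p : α → Prop, (∃ a, ¬p a) →
        (∀ x y z, ¬p x → ¬p y → ¬p z → x = y ∨ x = z ∨ y = z) → contract p f = 0 := by
      intro p hne hp
      obtain ⟨a, ha⟩ := hne
      refine ih _ (hm ▸ Fintype.card_subtype_lt ha)
        (fun g hg => tensorAct_contract ⟨a, ha⟩ hp hg (hf g hg)) (fun π hπ => ?_) rfl
      refine Eq.trans (by congr!) ((sum_blockTensor_mul_contract ⟨a, ha⟩ π f).trans (ho _ ?_))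
      rintro x y z (⟨hx, hy, h⟩ | ⟨hx, hy⟩) (⟨hx', hz, h'⟩ | ⟨hx', hz⟩)
      · simpa using hπ _ _ _ h h'
      · exact absurd hx hx'
      · exact absurd hx' hx
      · exact hp x y z hx hy hz
    refine eq_zero_of_contract_eq_zero hf (fun a => key _ ⟨a, by simp⟩ ?_)
      (fun a b _ => key _ ⟨a, by simp⟩ ?_)
    · grind
    · grind

theorem tensorAct_eq_of_mem_span {α ι : Type*} [Fintype α] [Fintype ι] {g : Matrix ι ι ℝ}
    (hg : IsBistochastic g) {f : (α → ι) → ℝ}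
    (hf : f ∈ Submodule.span ℝ {T | ∃ π : Setoid α, HasSmallBlocks π ∧ T = blockTensor π}) :
    tensorAct g f = f := by
  induction hf using Submodule.span_induction with
  | mem x h => obtain ⟨π, hπ, rfl⟩ := h; exact tensorAct_blockTensor hg hπ
  | zero => exact tensorAct_zero g
  | add x y _ _ hx hy => rw [tensorAct_add, hx, hy]
  | smul c x _ hx => rw [tensorAct_smul, hx]

/-- First fundamental theorem for the bistochastic group: the invariant tensors are spanned
by the tensors of partitions with blocks of size at most two. -/
theorem mem_span_blockTensor {α ι : Type*} [Fintype α] [Fintype ι] [Nonempty ι]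
    {f : (α → ι) → ℝ} (hf : ∀ g : Matrix ι ι ℝ, IsBistochastic g → tensorAct g f = f) :
    f ∈ Submodule.span ℝ {T | ∃ π : Setoid α, HasSmallBlocks π ∧ T = blockTensor π} := by
  let S := Submodule.span ℝ
    {T : (α → ι) → ℝ | ∃ π : Setoid α, HasSmallBlocks π ∧ T = blockTensor π}
  let e := WithLp.linearEquiv 2 ℝ ((α → ι) → ℝ)
  obtain ⟨y, hy, z, hz, hyz⟩ :=
    (S.comap e.toLinearMap).exists_add_mem_mem_orthogonal (e.symm f)
  have hfyz : f = e y + e z := by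
    rw [← map_add, ← hyz, LinearEquiv.apply_symm_apply]
  have hz0 : e z = 0 := by
    refine eq_zero_of_forall_sum_blockTensor (fun g hg => ?_) fun π hπ => ?_
    · have h := hf g hg
      have hy' : tensorAct g (e y) = e y := tensorAct_eq_of_mem_span hg hy
      rw [hfyz, tensorAct_add, hy'] at h
      exact add_left_cancel h
    · have hmem : e.symm (blockTensor π) ∈ S.comap e.toLinearMap := by
        have : blockTensor π ∈ S := Submodule.subset_span ⟨π, hπ, rfl⟩
        simpa using this
      have := (Submodule.mem_orthogonal _ _).1 hz _ hmem
      simpa [PiLp.inner_apply, e, mul_comm] using this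
  rw [hfyz, hz0, add_zero]
  exact hy

theorem tpow_mul_transpose {n k : ℕ} {g : Matrix (Fin n) (Fin n) ℝ} (hg : g * gᵀ = 1) :
    tpow n k g * (tpow n k g)ᵀ = 1 := by
  ext I J
  have h := sum_prod_mul_prod g gᵀ I J
  rw [hg, prod_one_apply] at h
  simp only [mul_apply, tpow, transpose_apply, of_apply, one_apply] at h ⊢
  norm_cast
  convert congrArg Complex.ofReal h
  split_ifs <;> simp

theorem intertwines_iff {n k l : ℕ} {g : Matrix (Fin n) (Fin n) ℝ} (hg : g * gᵀ = 1)
    (W : Matrix (Fin l → Fin n) (Fin k → Fin n) ℂ) :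
    W * tpow n k g = tpow n l g * W ↔ tpow n l g * W * (tpow n k g)ᵀ = W := by
  have h := tpow_mul_transpose (k := k) hg
  constructor
  · intro hW
    rw [← hW, Matrix.mul_assoc, h, Matrix.mul_one]
  · intro hW
    conv_lhs => rw [← hW]
    rw [Matrix.mul_assoc, mul_eq_one_comm.1 h, Matrix.mul_one]

/-- Conjugation by tensor powers acts on a matrix as on the tensor of its entries. -/
theorem tpow_mul_mul_transpose_apply {n k l : ℕ} (g : Matrix (Fin n) (Fin n) ℝ)
    (W : Matrix (Fin l → Fin n) (Fin k → Fin n) ℂ) (I : Fin l ⊕ Fin k → Fin n) :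
    (tpow n l g * W * (tpow n k g)ᵀ) (I ∘ Sum.inl) (I ∘ Sum.inr) =
      ∑ J : Fin l ⊕ Fin k → Fin n, ((∏ a, g (I a) (J a) : ℝ) : ℂ) *
        W (J ∘ Sum.inl) (J ∘ Sum.inr) := by
  rw [← (Equiv.sumArrowEquivProdArrow (Fin l) (Fin k) (Fin n)).symm.sum_comp,
    Fintype.sum_prod_type_right, mul_apply]
  refine Finset.sum_congr rfl fun K _ => ?_
  rw [mul_apply, Finset.sum_mul]
  refine Finset.sum_congr rfl fun J _ => ?_
  simp [tpow, Equiv.sumArrowEquivProdArrow, Function.comp_def]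
  ring

theorem mem_span_of_forall_intertwines {n k l : ℕ} [NeZero n]
    {W : Matrix (Fin l → Fin n) (Fin k → Fin n) ℂ}
    (hW : ∀ g, IsBistochastic g → W * tpow n k g = tpow n l g * W) :
    W ∈ Submodule.span ℂ {D | ∃ π : Setoid (Fin l ⊕ Fin k),
      (∀ s ∈ π.classes, s.ncard = 1 ∨ s.ncard = 2) ∧ D = Dmat n π} := by
  let Φ (f : (Fin l ⊕ Fin k → Fin n) → ℝ) : Matrix (Fin l → Fin n) (Fin k → Fin n) ℂ :=
    of fun I J => (f (Sum.elim I J) : ℂ)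
  have hΦ : ∀ f ∈ Submodule.span ℝ
      {T | ∃ π : Setoid (Fin l ⊕ Fin k), HasSmallBlocks π ∧ T = blockTensor π},
      Φ f ∈ Submodule.span ℂ {D | ∃ π : Setoid (Fin l ⊕ Fin k),
        (∀ s ∈ π.classes, s.ncard = 1 ∨ s.ncard = 2) ∧ D = Dmat n π} := by
    intro f hf
    induction hf using Submodule.span_induction with
    | mem x h =>
      obtain ⟨π, hπ, rfl⟩ := h
      refine Submodule.subset_span ⟨π, (hasSmallBlocks_iff π).1 hπ, ?_⟩
      ext I J
      simp only [Φ, Dmat, blockTensor, of_apply]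
      norm_cast
    | zero =>
      convert Submodule.zero_mem _
      ext I J; simp [Φ]
    | add x y _ _ hx hy =>
      convert Submodule.add_mem _ hx hy
      ext I J; simp [Φ]
    | smul c x _ hx =>
      convert Submodule.smul_mem _ (c : ℂ) hx
      ext I J; simp [Φ]
  have hinv : ∀ g : Matrix (Fin n) (Fin n) ℝ, IsBistochastic g → ∀ I : Fin l ⊕ Fin k → Fin n,
      W (I ∘ Sum.inl) (I ∘ Sum.inr) = ∑ J : Fin l ⊕ Fin k → Fin n,
        ((∏ a, g (I a) (J a) : ℝ) : ℂ) * W (J ∘ Sum.inl) (J ∘ Sum.inr) := by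
    intro g hg I
    rw [← tpow_mul_mul_transpose_apply, (intertwines_iff hg.mul_transpose_eq_one W).1 (hW g hg)]
  have hre := hΦ (fun I => (W (I ∘ Sum.inl) (I ∘ Sum.inr)).re) <|
      mem_span_blockTensor fun g hg => by
        ext I
        simp only [hinv g hg I, tensorAct, Complex.re_sum, Complex.re_ofReal_mul]
        congr!
  have him := hΦ (fun I => (W (I ∘ Sum.inl) (I ∘ Sum.inr)).im) <|
      mem_span_blockTensor fun g hg => by
        ext I
        simp only [hinv g hg I, tensorAct, Complex.im_sum, Complex.im_ofReal_mul]
        congr!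
  convert Submodule.add_mem _ hre (Submodule.smul_mem _ Complex.I him)
  ext I J
  simp [Φ, mul_comm Complex.I, Complex.re_add_im]

theorem Dmat_intertwines {n k l : ℕ} {π : Setoid (Fin l ⊕ Fin k)} (hπ : HasSmallBlocks π)
    {g : Matrix (Fin n) (Fin n) ℝ} (hg : IsBistochastic g) :
    Dmat n π * tpow n k g = tpow n l g * Dmat n π := by
  rw [intertwines_iff hg.mul_transpose_eq_one]
  have hD : ∀ I : Fin l ⊕ Fin k → Fin n,
      Dmat n π (I ∘ Sum.inl) (I ∘ Sum.inr) = (blockTensor π I : ℂ) := by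
    intro I
    simp only [Dmat, blockTensor, of_apply, Sum.elim_comp_inl_inr]
    norm_cast
  ext I J
  have h := tpow_mul_mul_transpose_apply g (Dmat n π) (Sum.elim I J)
  have h2 := congrFun (tensorAct_blockTensor hg hπ) (Sum.elim I J)
  have h3 := hD (Sum.elim I J)
  rw [← h2, tensorAct] at h3
  simp only [hD] at h
  push_cast at h h3
  exact h.trans (h3.trans (by congr!)).symm

/-- the set of matrices intertwining the tensor power representations of
the bistochastic group `B_n` (real orthogonal matrices whose rows and columns each sum
to `1`) is the ℂ-linear span of the partition matrices `D_π` of partitions all of whose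
blocks have size one or two. -/
theorem stmt_15 (n : ℕ) (hn : 0 < n) (k l : ℕ) :
    {W : Matrix (Fin l → Fin n) (Fin k → Fin n) ℂ |
        ∀ g : Matrix (Fin n) (Fin n) ℝ, g * gᵀ = 1 →
          (∀ i : Fin n, ∑ j : Fin n, g i j = 1) →
          (∀ j : Fin n, ∑ i : Fin n, g i j = 1) →
          W * tpow n k g = tpow n l g * W} =
      ↑(Submodule.span ℂ
          {D : Matrix (Fin l → Fin n) (Fin k → Fin n) ℂ |
            ∃ π : Setoid (Fin l ⊕ Fin k),
              (∀ s ∈ π.classes, s.ncard = 1 ∨ s.ncard = 2) ∧ D = Dmat n π}) := by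
  have : NeZero n := ⟨hn.ne'⟩
  ext W
  constructor
  · intro hW
    exact mem_span_of_forall_intertwines fun g hg =>
      hW g hg.mul_transpose_eq_one hg.row_sum hg.col_sum
  · intro hW g h1 h2 h3
    induction hW using Submodule.span_induction with
    | mem x h =>
      obtain ⟨π, hπ, rfl⟩ := h
      exact Dmat_intertwines ((hasSmallBlocks_iff π).2 hπ) ⟨by convert h1, h2, h3⟩
    | zero => simp
    | add x y _ _ hx hy => rw [Matrix.add_mul, Matrix.mul_add, hx, hy]
    | smul c x _ hx => rw [Matrix.smul_mul, Matrix.mul_smul, hx]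
end

section
/- Fix a positive integer n and natural numbers k, l. The set of matrices W : Matrix (Fin l → Fin n) (Fin k → Fin n) ℂ satisfying W * (ε^k • P_σ^{(k)}) = (ε^l • P_σ^{(l)}) * W for every permutation σ of Fin n and every ε ∈ {(1 : ℂ), -1} is a ℂ-subspace, and it is equal to the ℂ-linear span of the set {D_π : π a Setoid on Fin l ⊕ Fin k such that the number of equivalence classes of π of odd cardinality is even}. (This characterises the weight matrices of equivariant layers for the modified symmetric group S_n' = ℤ₂ × S_n, realised as the matrices ±P_σ.) -/
open Matrix
open scoped Classical

/-- The `k`-fold tensor power permutation matrix `P_σ^{(k)}`. -/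
noncomputable def Pmat (n k : ℕ) (σ : Equiv.Perm (Fin n)) :
    Matrix (Fin k → Fin n) (Fin k → Fin n) ℂ :=
  Matrix.of fun I J => if I = ⇑σ ∘ J then 1 else 0

theorem Setoid.even_ncard_odd_classes_iff {α : Type*} [Fintype α] (π : Setoid α) :
    Even ({s | s ∈ π.classes ∧ Odd s.ncard}.ncard) ↔ Even (Fintype.card α) := by
  have hfiber : ∀ s ∈ π.classes, {x | {y | π y x} = s} = s := by
    rintro s ⟨a, rfl⟩
    ext x
    refine ⟨fun h => ?_, fun h => ?_⟩
    · have hx : x ∈ {y | π y x} := π.refl x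
      exact (Set.ext_iff.mp h x).mp hx
    · ext y
      exact ⟨fun hy => π.trans hy h, fun hy => π.trans hy (π.symm h)⟩
  have hcard : Fintype.card α = ∑ s ∈ π.classes.toFinset, s.ncard := by
    rw [← Finset.card_univ, Finset.card_eq_sum_card_fiberwise
      (f := fun x => {y | π y x}) (t := π.classes.toFinset)
      (fun x _ => by simpa using π.mem_classes x)]
    refine Finset.sum_congr rfl fun s hs => ?_
    rw [← Set.ncard_coe_finset]
    simpa using congrArg Set.ncard (hfiber s (by simpa using hs))
  have hset : {s | s ∈ π.classes ∧ Odd s.ncard} =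
      ((π.classes.toFinset.filter fun s => Odd s.ncard : Finset (Set α)) : Set (Set α)) := by
    ext s; simp
  rw [hset, Set.ncard_coe_finset, hcard, ← Nat.not_odd_iff_even, ← Nat.not_odd_iff_even,
    Finset.odd_sum_iff_odd_card_odd]

instance Setoid.instFinite {α : Type*} [Finite α] : Finite (Setoid α) :=
  Finite.of_injective (fun π : Setoid α => π.r) fun _ _ h =>
    Setoid.ext fun a b => iff_of_eq (congrFun (congrFun h a) b)

theorem exists_perm_comp_eq_of_ker_eq {α β : Type*} [Finite β] {f g : α → β}
    (h : Setoid.ker f = Setoid.ker g) : ∃ σ : Equiv.Perm β, σ ∘ f = g := by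
  let q : Quotient (Setoid.ker f) ≃ Quotient (Setoid.ker g) :=
    Quotient.congr (Equiv.refl α) fun a b => by
      change Setoid.ker f a b ↔ Setoid.ker g a b
      rw [h]
  let e : Set.range f ≃ Set.range g :=
    (Setoid.quotientKerEquivRange f).symm.trans (q.trans (Setoid.quotientKerEquivRange g))
  refine ⟨Equiv.extendSubtype e, funext fun a => ?_⟩
  rw [Function.comp_apply, Equiv.extendSubtype_apply_of_mem e (f a) ⟨a, rfl⟩]
  have ha : (Setoid.quotientKerEquivRange f).symm ⟨f a, a, rfl⟩ = Quotient.mk _ a := by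
    rw [Equiv.symm_apply_eq]; rfl
  change ((Setoid.quotientKerEquivRange g (q ((Setoid.quotientKerEquivRange f).symm
    ⟨f a, a, rfl⟩)) : Set.range g) : β) = g a
  rw [ha]
  rfl

theorem Dmat_apply {n : ℕ} {α β : Type*} (π : Setoid (α ⊕ β)) (I : α → Fin n) (J : β → Fin n) :
    Dmat n π I J = if π ≤ Setoid.ker (Sum.elim I J) then 1 else 0 := rfl

/-- The indicator matrix of the pairs `(I, J)` whose level sets are exactly the blocks of `π`. -/
noncomputable def orbitMat (n : ℕ) {α β : Type*} (π : Setoid (α ⊕ β)) :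
    Matrix (α → Fin n) (β → Fin n) ℂ :=
  Matrix.of fun I J => if π = Setoid.ker (Sum.elim I J) then 1 else 0

theorem Dmat_eq_sum_orbitMat {n : ℕ} {α β : Type*} [Fintype (Setoid (α ⊕ β))]
    (π : Setoid (α ⊕ β)) :
    Dmat n π = ∑ ρ ∈ Finset.univ.filter (π ≤ ·), orbitMat n ρ := by
  ext I J
  simp [Dmat_apply, Matrix.sum_apply, orbitMat]

theorem orbitMat_mem_span_range_Dmat {n : ℕ} {α β : Type*} [Finite α] [Finite β]
    (π : Setoid (α ⊕ β)) :
    orbitMat n π ∈ Submodule.span ℂ (Set.range (Dmat n (α := α) (β := β))) := by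
  have := Fintype.ofFinite (Setoid (α ⊕ β))
  induction π using WellFoundedGT.induction with
  | ind π ih =>
    have hsplit := Dmat_eq_sum_orbitMat (n := n) π
    rw [← Finset.add_sum_erase _ _ (show π ∈ Finset.univ.filter (π ≤ ·) by simp)] at hsplit
    rw [eq_sub_of_add_eq hsplit.symm]
    refine sub_mem (Submodule.subset_span ⟨π, rfl⟩) (sum_mem fun ρ hρ => ih ρ ?_)
    simp only [Finset.mem_erase, Finset.mem_filter, Finset.mem_univ, true_and] at hρ
    exact lt_of_le_of_ne hρ.2 hρ.1.symm

theorem mem_span_range_Dmat_of_comp_perm {n : ℕ} {α β : Type*} [Finite α] [Finite β]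
    {W : Matrix (α → Fin n) (β → Fin n) ℂ}
    (hW : ∀ (σ : Equiv.Perm (Fin n)) I J, W (σ ∘ I) (σ ∘ J) = W I J) :
    W ∈ Submodule.span ℂ (Set.range (Dmat n (α := α) (β := β))) := by
  have := Fintype.ofFinite (Setoid (α ⊕ β))
  obtain ⟨c, hc⟩ : ∃ c : Setoid (α ⊕ β) → ℂ,
      ∀ I J, c (Setoid.ker (Sum.elim I J)) = W I J := by
    have hf : Function.FactorsThrough (fun p : (α ⊕ β) → Fin n => W (p ∘ Sum.inl) (p ∘ Sum.inr))
        (fun p => Setoid.ker p) := by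
      intro p q hpq
      obtain ⟨σ, rfl⟩ := exists_perm_comp_eq_of_ker_eq hpq
      exact (hW σ _ _).symm
    exact ⟨Function.extend _ _ 0, fun I J => hf.extend_apply 0 (Sum.elim I J)⟩
  have hsum : W = ∑ π, c π • orbitMat n π := by
    ext I J
    simp [Matrix.sum_apply, orbitMat, hc]
  rw [hsum]
  exact sum_mem fun π _ => Submodule.smul_mem _ _ (orbitMat_mem_span_range_Dmat π)

theorem Dmat_comp_perm {n : ℕ} {α β : Type*} (π : Setoid (α ⊕ β)) (σ : Equiv.Perm (Fin n))
    (I : α → Fin n) (J : β → Fin n) : Dmat n π (σ ∘ I) (σ ∘ J) = Dmat n π I J := by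
  have : Setoid.ker (Sum.elim (σ ∘ I) (σ ∘ J)) = Setoid.ker (Sum.elim I J) := by
    ext x y
    rw [← Sum.comp_elim]
    exact σ.injective.eq_iff
  rw [Dmat_apply, Dmat_apply, this]

theorem mul_Pmat_apply {n k : ℕ} {ι : Type*} (W : Matrix ι (Fin k → Fin n) ℂ)
    (σ : Equiv.Perm (Fin n)) (I : ι) (J : Fin k → Fin n) :
    (W * Pmat n k σ) I J = W I (σ ∘ J) := by
  simp [Matrix.mul_apply, Pmat]

theorem Pmat_mul_apply_comp {n l : ℕ} {ι : Type*} (W : Matrix (Fin l → Fin n) ι ℂ)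
    (σ : Equiv.Perm (Fin n)) (I : Fin l → Fin n) (J : ι) :
    (Pmat n l σ * W) (σ ∘ I) J = W I J := by
  simp [Matrix.mul_apply, Pmat, σ.injective.comp_left.eq_iff]

theorem mul_Pmat_eq_Pmat_mul_iff {n k l : ℕ} {W : Matrix (Fin l → Fin n) (Fin k → Fin n) ℂ}
    {σ : Equiv.Perm (Fin n)} :
    W * Pmat n k σ = Pmat n l σ * W ↔ ∀ I J, W (σ ∘ I) (σ ∘ J) = W I J := by
  refine ⟨fun h I J => ?_, fun h => ?_⟩
  · exact (mul_Pmat_apply W σ (σ ∘ I) J).symm.trans (by rw [h, Pmat_mul_apply_comp])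
  · ext I J
    obtain ⟨I, rfl⟩ : ∃ I', σ ∘ I' = I := ⟨σ.symm ∘ I, by ext; simp⟩
    rw [mul_Pmat_apply, Pmat_mul_apply_comp, h]

/-- the set of matrices intertwining the tensor power representations of
the modified symmetric group `S_n' = ℤ₂ × S_n` (realised as the matrices `±P_σ`, whose
`k`-fold tensor powers are `ε^k • P_σ^{(k)}`) is the ℂ-linear span of the partition
matrices `D_π` of partitions having an even number of blocks of odd size. -/
theorem stmt_16 (n : ℕ) (hn : 0 < n) (k l : ℕ) :
    {W : Matrix (Fin l → Fin n) (Fin k → Fin n) ℂ |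
        ∀ (σ : Equiv.Perm (Fin n)) (ε : ℂ), ε = 1 ∨ ε = -1 →
          W * (ε ^ k • Pmat n k σ) = (ε ^ l • Pmat n l σ) * W} =
      ↑(Submodule.span ℂ
          {D : Matrix (Fin l → Fin n) (Fin k → Fin n) ℂ |
            ∃ π : Setoid (Fin l ⊕ Fin k),
              Even ({s | s ∈ π.classes ∧ Odd s.ncard}.ncard) ∧ D = Dmat n π}) := by
  simp only [Setoid.even_ncard_odd_classes_iff, Fintype.card_sum, Fintype.card_fin]
  ext W
  simp only [Set.mem_ofPred_eq, SetLike.mem_coe]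
  rcases Nat.even_or_odd (l + k) with hlk | hlk
  · have hrange : {D : Matrix (Fin l → Fin n) (Fin k → Fin n) ℂ |
        ∃ π : Setoid (Fin l ⊕ Fin k), Even (l + k) ∧ D = Dmat n π} =
        Set.range (Dmat n) := by
      ext D
      simp [hlk, eq_comm]
    rw [hrange]
    refine ⟨fun hW => mem_span_range_Dmat_of_comp_perm fun σ => ?_, fun hW σ ε hε => ?_⟩
    · exact mul_Pmat_eq_Pmat_mul_iff.mp (by simpa using hW σ 1 (Or.inl rfl))
    · have hpow : ε ^ k = ε ^ l := by
        rcases hε with rfl | rfl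
        · simp
        · exact neg_one_pow_congr (Nat.even_add.mp hlk).symm
      have hcomm : W * Pmat n k σ = Pmat n l σ * W := by
        induction hW using Submodule.span_induction with
        | mem D hD =>
          obtain ⟨π, rfl⟩ := hD
          exact mul_Pmat_eq_Pmat_mul_iff.mpr (Dmat_comp_perm π σ)
        | zero => simp
        | add A B _ _ hA hB => rw [Matrix.add_mul, Matrix.mul_add, hA, hB]
        | smul c A _ hA => rw [Matrix.smul_mul, Matrix.mul_smul, hA]
      rw [Matrix.mul_smul, Matrix.smul_mul, hpow, hcomm]
  · have hempty : {D : Matrix (Fin l → Fin n) (Fin k → Fin n) ℂ |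
        ∃ π : Setoid (Fin l ⊕ Fin k), Even (l + k) ∧ D = Dmat n π} = ∅ := by
      ext D
      simp [Nat.not_even_iff_odd.mpr hlk]
    rw [hempty, Submodule.span_empty, Submodule.mem_bot]
    refine ⟨fun hW => ?_, fun hW => by simp [hW]⟩
    have hone := mul_Pmat_eq_Pmat_mul_iff.mp (by simpa using hW 1 1 (Or.inl rfl))
    have hneg := hW 1 (-1) (Or.inr rfl)
    ext I J
    have hentry := congrFun (congrFun hneg ((1 : Equiv.Perm (Fin n)) ∘ I)) J
    rw [Matrix.mul_smul, Matrix.smul_mul, Matrix.smul_apply, Matrix.smul_apply,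
      mul_Pmat_apply, Pmat_mul_apply_comp, hone] at hentry
    rcases Nat.even_or_odd k with hk | hk
    · have hl : Odd l := by grind
      rw [hk.neg_one_pow, hl.neg_one_pow, one_smul, neg_one_smul] at hentry
      exact self_eq_neg.mp hentry
    · have hl : Even l := by grind
      rw [hk.neg_one_pow, hl.neg_one_pow, one_smul, neg_one_smul] at hentry
      exact neg_eq_self.mp hentry
end
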